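/- Fix s > 0 and define F_s(q,r) = GD_E(q||r) + s·Loss(q), where Loss(q) = Σ_{(v,u)∈E} p(v) q(u|v) ℓ̃(v,u). Then for any conditional distributions q (with supp(q) ⊆ E) and r, the identity F_s(q,r) = F_s(q_s*(r), r) + GD_E(q||q_s*(r)) holds, where q_s*(r)(u|v) = e^{-s ℓ̃(v,u)} Π_{w'} r(u|w')^{p(w'|u,v)} / Σ_{u'∈E_v} e^{-s ℓ̃(v,u')} Π_{w'} r(u'|w')^{p(w'|u',v)} and GD_E(q||q_s*(r)) = Σ_{(v,u)∈E} p(v) q(u|v) log(q(u|v)/q_s*(r)(u|v)) ≥ 0. In particular q_s*(r) minimizes F_s(·, r). -/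

import Mathlib

open Real

noncomputable section

variable {V U W : Type*} [Fintype V] [Fintype U] [Fintype W]
  [DecidableEq V] [DecidableEq U]

/-- `q(u|v)` is a conditional distribution supported on the edge set `E`. -/
def CondDistOn (E : Finset (V × U)) (q : V → U → ℝ) : Prop :=
  (∀ v u, 0 ≤ q v u) ∧ (∀ v, ∑ u, q v u = 1) ∧ (∀ v u, q v u ≠ 0 → (v, u) ∈ E)

/-- Generalized K-L divergence `GD_E(q‖r)`. -/
def GDE (E : Finset (V × U)) (p : V → ℝ) (pw : V → U → W → ℝ)
    (q : V → U → ℝ) (r : W → U → ℝ) : ℝ :=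
  ∑ v, ∑ u, ∑ w, if (v, u) ∈ E then p v * q v u * pw v u w * Real.log (q v u / r w u) else 0

/-- Expected loss `Loss(q) = Σ p(v) q(u|v) ℓ̃(v,u)`. -/
def LossE (E : Finset (V × U)) (p : V → ℝ) (lt : V → U → ℝ) (q : V → U → ℝ) : ℝ :=
  ∑ v, ∑ u, if (v, u) ∈ E then p v * q v u * lt v u else 0

/-- The joint distribution `p(v,u,w) = p(v) q(u|v) p(w|u,v)`. -/
def jointD (E : Finset (V × U)) (p : V → ℝ) (pw : V → U → W → ℝ) (q : V → U → ℝ)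
    (v : V) (u : U) (w : W) : ℝ :=
  if (v, u) ∈ E then p v * q v u * pw v u w else 0

/-- Marginal `p(u)`. -/
def margU (p : V → ℝ) (q : V → U → ℝ) (u : U) : ℝ := ∑ v, p v * q v u

/-- Marginal `p(u,w)`. -/
def margUW (E : Finset (V × U)) (p : V → ℝ) (pw : V → U → W → ℝ) (q : V → U → ℝ)
    (u : U) (w : W) : ℝ := ∑ v, jointD E p pw q v u w

/-- Marginal `p(w)`. -/
def margW (E : Finset (V × U)) (p : V → ℝ) (pw : V → U → W → ℝ) (q : V → U → ℝ)
    (w : W) : ℝ := ∑ u, margUW E p pw q u w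

/-- Mutual information `I(U;V)`. -/
def IUV (p : V → ℝ) (q : V → U → ℝ) : ℝ :=
  ∑ v, ∑ u, p v * q v u * Real.log (q v u / margU p q u)

/-- Mutual information `I(U;W)`. -/
def IUW (E : Finset (V × U)) (p : V → ℝ) (pw : V → U → W → ℝ) (q : V → U → ℝ) : ℝ :=
  ∑ u, ∑ w, margUW E p pw q u w *
    Real.log (margUW E p pw q u w / (margU p q u * margW E p pw q w))

/-- Objective `I(U;V) - I(U;W)`. -/
def Obj (E : Finset (V × U)) (p : V → ℝ) (pw : V → U → W → ℝ) (q : V → U → ℝ) : ℝ :=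
  IUV p q - IUW E p pw q

/-- The induced conditional distribution `r*(q)(u|w)`. -/
def rstar (E : Finset (V × U)) (p : V → ℝ) (pw : V → U → W → ℝ) (q : V → U → ℝ)
    (w : W) (u : U) : ℝ := margUW E p pw q u w / margW E p pw q w

/-- Gibbs update `q_s^*(r)(u|v)`. -/
def qstar (E : Finset (V × U)) (pw : V → U → W → ℝ) (lt : V → U → ℝ)
    (s : ℝ) (r : W → U → ℝ) (v : V) (u : U) : ℝ :=
  (if (v, u) ∈ E then Real.exp (-s * lt v u) * ∏ w', r w' u ^ pw v u w' else 0) /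
  (∑ u', if (v, u') ∈ E then Real.exp (-s * lt v u') * ∏ w', r w' u' ^ pw v u' w' else 0)

/-- The penalty (Lagrangian) function `F_s(q,r)`. -/
def FPen (E : Finset (V × U)) (p : V → ℝ) (pw : V → U → W → ℝ) (lt : V → U → ℝ)
    (s : ℝ) (q : V → U → ℝ) (r : W → U → ℝ) : ℝ :=
  GDE E p pw q r + s * LossE E p lt q

/-- Generalized K-L divergence between two conditional distributions on `E`. -/
def GDcond (E : Finset (V × U)) (p : V → ℝ) (q1 q2 : V → U → ℝ) : ℝ :=
  ∑ v, ∑ u, if (v, u) ∈ E then p v * q1 v u * Real.log (q1 v u / q2 v u) else 0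

/-- Conditional K-L divergence `GD_q(r1‖r2)` weighted by `q(w)`. -/
def GDr (E : Finset (V × U)) (p : V → ℝ) (pw : V → U → W → ℝ) (q : V → U → ℝ)
    (r1 r2 : W → U → ℝ) : ℝ :=
  ∑ u, ∑ w, margW E p pw q w * r1 w u * Real.log (r1 w u / r2 w u)

/-- The target-loss function `T(L)` (valued in `EReal`, `+∞` if infeasible). -/
def TL (E : Finset (V × U)) (p : V → ℝ) (pw : V → U → W → ℝ) (lt : V → U → ℝ)
    (L : ℝ) : EReal :=
  sInf {x : EReal | ∃ q, CondDistOn E q ∧ LossE E p lt q ≤ L ∧ x = (Obj E p pw q : EReal)}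

lemma qs_num_pos (pw : V → U → W → ℝ) (lt : V → U → ℝ) (s : ℝ) (r : W → U → ℝ)
    (hr : ∀ w u, r w u ∈ Set.Ioc (0 : ℝ) 1) (v : V) (u : U) :
    0 < Real.exp (-s * lt v u) * ∏ w', r w' u ^ pw v u w' :=
  mul_pos (Real.exp_pos _) (Finset.prod_pos fun w _ => Real.rpow_pos_of_pos (hr w u).1 _)

/-- The normalizing constant. -/
def qsZ (E : Finset (V × U)) (pw : V → U → W → ℝ) (lt : V → U → ℝ)
    (s : ℝ) (r : W → U → ℝ) (v : V) : ℝ :=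
  ∑ u', if (v, u') ∈ E then Real.exp (-s * lt v u') * ∏ w', r w' u' ^ pw v u' w' else 0

lemma qsZ_pos (E : Finset (V × U)) (hE : ∀ v : V, ∃ u, (v, u) ∈ E)
    (pw : V → U → W → ℝ) (lt : V → U → ℝ) (s : ℝ) (r : W → U → ℝ)
    (hr : ∀ w u, r w u ∈ Set.Ioc (0 : ℝ) 1) (v : V) : 0 < qsZ E pw lt s r v := by
  obtain ⟨u, hu⟩ := hE v
  refine Finset.sum_pos' (fun u' _ => ?_) ⟨u, Finset.mem_univ _, ?_⟩
  · split_ifs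
    · exact (qs_num_pos pw lt s r hr v u').le
    · exact le_rfl
  · rw [if_pos hu]; exact qs_num_pos pw lt s r hr v u

lemma qstar_pos (E : Finset (V × U)) (hE : ∀ v : V, ∃ u, (v, u) ∈ E)
    (pw : V → U → W → ℝ) (lt : V → U → ℝ) (s : ℝ) (r : W → U → ℝ)
    (hr : ∀ w u, r w u ∈ Set.Ioc (0 : ℝ) 1) (v : V) (u : U) (h : (v, u) ∈ E) :
    0 < qstar E pw lt s r v u := by
  unfold qstar
  rw [if_pos h]
  exact div_pos (qs_num_pos pw lt s r hr v u) (qsZ_pos E hE pw lt s r hr v)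

lemma qstar_zero (E : Finset (V × U)) (pw : V → U → W → ℝ) (lt : V → U → ℝ) (s : ℝ)
    (r : W → U → ℝ) (v : V) (u : U) (h : (v, u) ∉ E) : qstar E pw lt s r v u = 0 := by
  unfold qstar
  rw [if_neg h, zero_div]

lemma qstar_cond (E : Finset (V × U)) (hE : ∀ v : V, ∃ u, (v, u) ∈ E)
    (pw : V → U → W → ℝ) (lt : V → U → ℝ) (s : ℝ) (r : W → U → ℝ)
    (hr : ∀ w u, r w u ∈ Set.Ioc (0 : ℝ) 1) : CondDistOn E (qstar E pw lt s r) := by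
  refine ⟨fun v u => ?_, fun v => ?_, fun v u h => ?_⟩
  · by_cases h : (v, u) ∈ E
    · exact (qstar_pos E hE pw lt s r hr v u h).le
    · exact (qstar_zero E pw lt s r v u h).ge
  · unfold qstar
    rw [← Finset.sum_div]
    exact div_self (qsZ_pos E hE pw lt s r hr v).ne'
  · by_contra h'
    exact h (qstar_zero E pw lt s r v u h')

lemma log_qstar (E : Finset (V × U)) (hE : ∀ v : V, ∃ u, (v, u) ∈ E)
    (pw : V → U → W → ℝ) (lt : V → U → ℝ) (s : ℝ) (r : W → U → ℝ)
    (hr : ∀ w u, r w u ∈ Set.Ioc (0 : ℝ) 1) (v : V) (u : U) (h : (v, u) ∈ E) :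
    Real.log (qstar E pw lt s r v u)
      = -s * lt v u + ∑ w, pw v u w * Real.log (r w u) - Real.log (qsZ E pw lt s r v) := by
  have hP : ∀ w ∈ Finset.univ, r w u ^ pw v u w ≠ 0 :=
    fun w _ => (Real.rpow_pos_of_pos (hr w u).1 _).ne'
  have e : qstar E pw lt s r v u
      = (Real.exp (-s * lt v u) * ∏ w', r w' u ^ pw v u w') / qsZ E pw lt s r v := by
    unfold qstar qsZ
    rw [if_pos h]
  rw [e, Real.log_div (qs_num_pos pw lt s r hr v u).ne' (qsZ_pos E hE pw lt s r hr v).ne',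
    Real.log_mul (Real.exp_pos _).ne' (Finset.prod_ne_zero_iff.2 hP), Real.log_exp,
    Real.log_prod hP]
  simp only [Real.log_rpow (hr _ u).1]

lemma FPen_eq (E : Finset (V × U)) (hE : ∀ v : V, ∃ u, (v, u) ∈ E)
    (p : V → ℝ) (pw : V → U → W → ℝ)
    (hpw1 : ∀ v u, (v, u) ∈ E → ∑ w, pw v u w = 1)
    (lt : V → U → ℝ) (s : ℝ) (r : W → U → ℝ)
    (hr : ∀ w u, r w u ∈ Set.Ioc (0 : ℝ) 1) (q : V → U → ℝ) (hq : CondDistOn E q) :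
    FPen E p pw lt s q r
      = GDcond E p q (qstar E pw lt s r) - ∑ v, p v * Real.log (qsZ E pw lt s r v) := by
  unfold FPen GDE LossE GDcond
  rw [Finset.mul_sum, ← Finset.sum_add_distrib, ← Finset.sum_sub_distrib]
  refine Finset.sum_congr rfl fun v _ => ?_
  have e : p v * Real.log (qsZ E pw lt s r v)
      = ∑ u, q v u * (p v * Real.log (qsZ E pw lt s r v)) := by
    rw [← Finset.sum_mul, hq.2.1 v, one_mul]
  rw [e, Finset.mul_sum, ← Finset.sum_add_distrib, ← Finset.sum_sub_distrib]
  refine Finset.sum_congr rfl fun u _ => ?_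
  by_cases h0 : q v u = 0
  · simp [h0]
  have h := hq.2.2 v u h0
  simp only [if_pos h]
  have e2 : ∑ w, p v * q v u * pw v u w * Real.log (q v u / r w u)
      = p v * q v u * (Real.log (q v u) - ∑ w, pw v u w * Real.log (r w u)) := by
    have : Real.log (q v u) = ∑ w, pw v u w * Real.log (q v u) := by
      rw [← Finset.sum_mul, hpw1 v u h, one_mul]
    rw [this, ← Finset.sum_sub_distrib, Finset.mul_sum]
    refine Finset.sum_congr rfl fun w _ => ?_
    rw [Real.log_div h0 (hr w u).1.ne']
    ring
  rw [e2, Real.log_div h0 (qstar_pos E hE pw lt s r hr v u h).ne',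
    log_qstar E hE pw lt s r hr v u h]
  ring

lemma GDcond_self (E : Finset (V × U)) (p : V → ℝ) (q : V → U → ℝ) : GDcond E p q q = 0 := by
  unfold GDcond
  refine Finset.sum_eq_zero fun v _ => Finset.sum_eq_zero fun u _ => ?_
  by_cases h0 : q v u = 0
  · simp [h0]
  · simp [div_self h0]

lemma GDcond_nonneg (E : Finset (V × U)) (p : V → ℝ) (hp : ∀ v, 0 < p v) (q q' : V → U → ℝ)
    (hq : CondDistOn E q) (hq' : CondDistOn E q') (hpos : ∀ v u, (v, u) ∈ E → 0 < q' v u) :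
    0 ≤ GDcond E p q q' := by
  unfold GDcond
  refine Finset.sum_nonneg fun v _ => ?_
  have e : (0 : ℝ) = ∑ u, p v * (q v u - q' v u) := by
    rw [← Finset.mul_sum, Finset.sum_sub_distrib, hq.2.1, hq'.2.1]
    ring
  refine e.le.trans (Finset.sum_le_sum fun u _ => ?_)
  by_cases h0 : q v u = 0
  · have := mul_nonneg (hp v).le (hq'.1 v u)
    simp [h0, this]
  have h := hq.2.2 v u h0
  have hqp : 0 < q v u := lt_of_le_of_ne (hq.1 v u) (Ne.symm h0)
  rw [if_pos h, mul_assoc]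
  refine mul_le_mul_of_nonneg_left ?_ (hp v).le
  have h1 := Real.one_sub_inv_le_log_of_pos (div_pos hqp (hpos v u h))
  have h2 := mul_le_mul_of_nonneg_left h1 hqp.le
  have h3 : q v u * (1 - (q v u / q' v u)⁻¹) = q v u - q' v u := by
    rw [inv_div]
    field_simp
  linarith

/-- the Gibbs update `q_s^*(r)` minimizes `q ↦ F_s(q,r)`, via the identity
`F_s(q,r) = F_s(q_s^*(r),r) + GD_E(q‖q_s^*(r))` with `GD_E(q‖q_s^*(r)) ≥ 0`. -/
theorem qstar_minimizes
    (E : Finset (V × U)) (hE : ∀ v : V, ∃ u, (v, u) ∈ E)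
    (p : V → ℝ) (hp : ∀ v, 0 < p v) (hp1 : ∑ v, p v = 1)
    (pw : V → U → W → ℝ) (hpw0 : ∀ v u w, 0 ≤ pw v u w)
    (hpw1 : ∀ v u, (v, u) ∈ E → ∑ w, pw v u w = 1)
    (lt : V → U → ℝ) (hlt : ∀ v u, 0 ≤ lt v u)
    (s : ℝ) (hs : 0 < s)
    (r : W → U → ℝ) (hr : ∀ w u, r w u ∈ Set.Ioc (0 : ℝ) 1)
    (q : V → U → ℝ) (hq : CondDistOn E q) :
    FPen E p pw lt s q r
        = FPen E p pw lt s (qstar E pw lt s r) r + GDcond E p q (qstar E pw lt s r)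
      ∧ 0 ≤ GDcond E p q (qstar E pw lt s r)
      ∧ FPen E p pw lt s (qstar E pw lt s r) r ≤ FPen E p pw lt s q r := by
  have hc := qstar_cond E hE pw lt s r hr
  have h1 := FPen_eq E hE p pw hpw1 lt s r hr q hq
  have h2 := FPen_eq E hE p pw hpw1 lt s r hr _ hc
  rw [GDcond_self] at h2
  have h3 := GDcond_nonneg E p hp q _ hq hc (qstar_pos E hE pw lt s r hr)
  refine ⟨by linarith, h3, by linarith⟩
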